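/- arXiv:nlin/0004015 — 4 statements merged into one kernel-verified Lean document; each statement's English description precedes it below -/
import Mathlib

section
/- Let u, v : ℝ³ → ℝ be smooth functions of the variables (x,y,z) satisfying u_y = 2 v_x. Define the differential operators P and C acting on smooth functions f : ℝ³ → ℝ by P f = f_xx + u·f and C f = v·f_x + (3/4)·u_y·f. Then the commutator [P∂_y + C, P] acts as multiplication by the function (1/4)u_xxy + v·u_x + u·u_y; that is, for every smooth f : ℝ³ → ℝ one has P((Pf)_y) + C(Pf) − P(P(f_y)) − P(Cf) = ((1/4)u_xxy + v·u_x + u·u_y)·f. Consequently, the Lax equation ∂P/∂z = [P∂_y + C, P] (meaning u_z·f = [P∂_y+C,P]f for all smooth f) holds if and only if u_z = (1/4)u_xxy + v·u_x + u·u_y (Bogoyavlensky's 2+1-dimensional equation). -/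
noncomputable section

/-- Partial derivative of `f : ℝ³ → ℝ` in the `k`-th coordinate direction. -/
def pd {n : ℕ} (k : Fin n) (f : (Fin n → ℝ) → ℝ) : (Fin n → ℝ) → ℝ :=
  fun x => deriv (fun t => f (Function.update x k t)) (x k)

/-- The operator `P f = f_xx + u·f` (coordinates: `x = 0`, `y = 1`, `z = 2`). -/
def Pop (u : (Fin 3 → ℝ) → ℝ) (f : (Fin 3 → ℝ) → ℝ) : (Fin 3 → ℝ) → ℝ :=
  fun p => pd 0 (pd 0 f) p + u p * f p

/-- The operator `C f = v·f_x + (3/4)·u_y·f`. -/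
def Cop (u v : (Fin 3 → ℝ) → ℝ) (f : (Fin 3 → ℝ) → ℝ) : (Fin 3 → ℝ) → ℝ :=
  fun p => v p * pd 0 f p + (3/4) * pd 1 u p * f p

/-- The commutator `[P∂_y + C, P] f = P((Pf)_y) + C(Pf) − P(P(f_y)) − P(Cf)`. -/
def laxBr (u v : (Fin 3 → ℝ) → ℝ) (f : (Fin 3 → ℝ) → ℝ) : (Fin 3 → ℝ) → ℝ :=
  fun p => Pop u (pd 1 (Pop u f)) p + Cop u v (Pop u f) p
    - Pop u (Pop u (pd 1 f)) p - Pop u (Cop u v f) p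

open scoped ContDiff

section PartialDerivative

variable {n : ℕ} {f g : (Fin n → ℝ) → ℝ}

lemma pd_eq_fderiv (k : Fin n) (hf : Differentiable ℝ f) :
    pd k f = fun x => fderiv ℝ f x (Pi.single k 1) := by
  funext x
  have h : HasFDerivAt f (fderiv ℝ f x) (Function.update x k (x k)) := by
    simpa using (hf x).hasFDerivAt
  exact (h.comp_hasDerivAt (x k) (hasDerivAt_update x k (x k))).deriv

lemma ContDiff.pd (k : Fin n) (hf : ContDiff ℝ ∞ f) : ContDiff ℝ ∞ (pd k f) := by
  rw [pd_eq_fderiv k (hf.differentiable (by simp))]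
  exact (hf.fderiv_right (by simp)).clm_apply contDiff_const

lemma pd_add (k : Fin n) (hf : ContDiff ℝ ∞ f) (hg : ContDiff ℝ ∞ g) :
    pd k (fun x => f x + g x) = fun x => pd k f x + pd k g x := by
  have hf' := hf.differentiable (by simp)
  have hg' := hg.differentiable (by simp)
  rw [pd_eq_fderiv k (hf'.fun_add hg'), pd_eq_fderiv k hf', pd_eq_fderiv k hg']
  funext x
  rw [fderiv_fun_add (hf' x) (hg' x)]
  rfl

lemma pd_mul (k : Fin n) (hf : ContDiff ℝ ∞ f) (hg : ContDiff ℝ ∞ g) :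
    pd k (fun x => f x * g x) = fun x => f x * pd k g x + pd k f x * g x := by
  have hf' := hf.differentiable (by simp)
  have hg' := hg.differentiable (by simp)
  rw [pd_eq_fderiv k (hf'.fun_mul hg'), pd_eq_fderiv k hf', pd_eq_fderiv k hg']
  funext x
  rw [fderiv_fun_mul (hf' x) (hg' x)]
  simp [mul_comm]

lemma pd_const_mul (k : Fin n) (c : ℝ) : pd k (fun x => c * f x) = fun x => c * pd k f x := by
  funext x
  exact deriv_const_mul_field c

lemma pd_comm (j k : Fin n) (hf : ContDiff ℝ ∞ f) : pd j (pd k f) = pd k (pd j f) := by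
  have hf' := hf.differentiable (by simp)
  have hd : Differentiable ℝ (fderiv ℝ f) :=
    (hf.fderiv_right (m := ∞) (by simp)).differentiable (by simp)
  have key (i l : Fin n) :
      pd i (pd l f) = fun x => fderiv ℝ (fderiv ℝ f) x (Pi.single i 1) (Pi.single l 1) := by
    rw [pd_eq_fderiv i ((hf.pd l).differentiable (by simp)), pd_eq_fderiv l hf']
    funext x
    rw [fderiv_clm_apply (hd x) (differentiableAt_const _)]
    simp
  rw [key, key]
  funext x
  exact hf.contDiffAt.isSymmSndFDerivAt
    (by simpa using WithTop.coe_le_coe.2 (le_top : (2 : ℕ∞) ≤ ⊤)) _ _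

end PartialDerivative

lemma laxBr_eq {u v f : (Fin 3 → ℝ) → ℝ} (hu : ContDiff ℝ ∞ u) (hv : ContDiff ℝ ∞ v)
    (hf : ContDiff ℝ ∞ f) (huv : ∀ p, pd 1 u p = 2 * pd 0 v p) (p : Fin 3 → ℝ) :
    laxBr u v f p
      = ((1/4) * pd 0 (pd 0 (pd 1 u)) p + v p * pd 0 u p + u p * pd 1 u p) * f p := by
  have hfx := hf.pd 0
  have hfxx := hfx.pd 0
  have hfy := hf.pd 1
  have huy := hu.pd 1
  have hyP : pd 1 (Pop u f) = fun p => Pop u (pd 1 f) p + pd 1 u p * f p := by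
    unfold Pop
    rw [pd_add 1 hfxx (hu.mul hf), pd_mul 1 hu hf, pd_comm 1 0 hfx, pd_comm 1 0 hf]
    funext q
    ring
  have hPop {g : (Fin 3 → ℝ) → ℝ} (hg : ContDiff ℝ ∞ g) : ContDiff ℝ ∞ (Pop u g) :=
    ((hg.pd 0).pd 0).add (hu.mul hg)
  have hxP : pd 0 (Pop u f) = fun p =>
      pd 0 (pd 0 (pd 0 f)) p + (u p * pd 0 f p + pd 0 u p * f p) := by
    unfold Pop
    rw [pd_add 0 hfxx (hu.mul hf), pd_mul 0 hu hf]
  have hxx {a b : (Fin 3 → ℝ) → ℝ} (ha : ContDiff ℝ ∞ a) (hb : ContDiff ℝ ∞ b) :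
      pd 0 (pd 0 (fun p => a p * b p)) = fun p =>
        a p * pd 0 (pd 0 b) p + 2 * (pd 0 a p * pd 0 b p) + pd 0 (pd 0 a) p * b p := by
    rw [pd_mul 0 ha hb, pd_add 0 (ha.mul (hb.pd 0)) ((ha.pd 0).mul hb), pd_mul 0 ha (hb.pd 0),
      pd_mul 0 (ha.pd 0) hb]
    funext q
    ring
  have hxxadd {a b : (Fin 3 → ℝ) → ℝ} (ha : ContDiff ℝ ∞ a) (hb : ContDiff ℝ ∞ b) :
      pd 0 (pd 0 (fun p => a p + b p)) = fun p => pd 0 (pd 0 a) p + pd 0 (pd 0 b) p := by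
    rw [pd_add 0 ha hb, pd_add 0 (ha.pd 0) (hb.pd 0)]
  have hcuy : ContDiff ℝ ∞ (fun p => (3/4) * pd 1 u p) := contDiff_const.mul huy
  have hxxC : pd 0 (pd 0 (Cop u v f)) = fun p =>
      (v p * pd 0 (pd 0 (pd 0 f)) p + 2 * (pd 0 v p * pd 0 (pd 0 f) p) + pd 0 (pd 0 v) p * pd 0 f p)
      + ((3/4) * pd 1 u p * pd 0 (pd 0 f) p + 2 * ((3/4) * pd 0 (pd 1 u) p * pd 0 f p)
        + (3/4) * pd 0 (pd 0 (pd 1 u)) p * f p) := by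
    unfold Cop
    rw [hxxadd (hv.mul hfx) (hcuy.mul hf), hxx hv hfx, hxx hcuy hf, pd_const_mul, pd_const_mul]
  have huyx : pd 0 (pd 1 u) p = 2 * pd 0 (pd 0 v) p := by
    rw [funext huv, pd_const_mul]
  have hcomm : laxBr u v f p = Pop u (fun p => pd 1 u p * f p) p + Cop u v (Pop u f) p
      - Pop u (Cop u v f) p := by
    unfold laxBr
    rw [hyP]
    simp only [Pop.eq_1 u (fun p => Pop u (pd 1 f) p + pd 1 u p * f p),
      Pop.eq_1 u (Pop u (pd 1 f)), Pop.eq_1 u (fun p => pd 1 u p * f p),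
      hxxadd (hPop hfy) (huy.mul hf)]
    ring
  rw [hcomm, Pop.eq_1 u (fun p => pd 1 u p * f p), hxx huy hf, Cop.eq_1 u v (Pop u f), hxP,
    Pop.eq_1 u (Cop u v f), hxxC]
  simp only [Pop, Cop]
  linear_combination pd 0 (pd 0 f) p * huv p + (1/2) * pd 0 f p * huyx

/-- for smooth `u, v : ℝ³ → ℝ` with `u_y = 2 v_x`, the commutator
`[P∂_y + C, P]` acts as multiplication by `(1/4)u_xxy + v·u_x + u·u_y`; consequently the
Lax equation `∂P/∂z = [P∂_y + C, P]` holds iff `u_z = (1/4)u_xxy + v·u_x + u·u_y`. -/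
theorem statement0 (u v : (Fin 3 → ℝ) → ℝ)
    (hu : ContDiff ℝ (⊤ : ℕ∞) u) (hv : ContDiff ℝ (⊤ : ℕ∞) v)
    (huv : ∀ p, pd 1 u p = 2 * pd 0 v p) :
    (∀ f : (Fin 3 → ℝ) → ℝ, ContDiff ℝ (⊤ : ℕ∞) f → ∀ p,
        laxBr u v f p
          = ((1/4) * pd 0 (pd 0 (pd 1 u)) p + v p * pd 0 u p + u p * pd 1 u p) * f p)
    ∧ ((∀ f : (Fin 3 → ℝ) → ℝ, ContDiff ℝ (⊤ : ℕ∞) f → ∀ p,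
          pd 2 u p * f p = laxBr u v f p)
        ↔ ∀ p, pd 2 u p
            = (1/4) * pd 0 (pd 0 (pd 1 u)) p + v p * pd 0 u p + u p * pd 1 u p) := by
  have h := fun f hf p => laxBr_eq (f := f) hu hv hf huv p
  refine ⟨h, fun hlax p => ?_, fun hz f hf p => by rw [h f hf p, hz p]⟩
  have h1 := hlax (fun _ => 1) contDiff_const p
  rw [h _ contDiff_const p] at h1
  simpa only [mul_one] using h1
end
end

section
/- Fix an integer ℓ ≥ 2. For X ∈ M_ℓ(ℂ) and m ∈ ℤ define the banded infinite matrix ι(Xs^m) by ι(Xs^m)(i,j) = X_{a,b} whenever i−1 = pℓ+a and j−1 = qℓ+b with a,b ∈ {0,…,ℓ−1}, p,q ∈ ℤ and q−p = m, and ι(Xs^m)(i,j) = 0 otherwise. Then for all X, Y ∈ M_ℓ(ℂ) and all m, n ∈ ℤ: (a) ι(Xs^m)·ι(Ys^n) = ι((XY)s^{m+n}) (matrix product), so in particular the matrix commutator satisfies [ι(Xs^m), ι(Ys^n)] = ι([X,Y]s^{m+n}); and (b) ω(ι(Xs^m), ι(Ys^n)) = m·δ_{m+n,0}·tr(XY).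 (This gives the affine commutation relation [Xs^m, Ys^n] = [X,Y]s^{m+n} + m δ_{m+n,0} tr(XY)·c, showing ι_ℓ embeds the affine Lie algebra of sl_ℓ into gl(∞).) -/
noncomputable section

/-- Product of banded infinite matrices: `(MN)(i,j) = Σ_k M(i,k)N(k,j)` (a finite
sum for banded matrices, formalized by `finsum`). -/
def matMul (M N : ℤ → ℤ → ℂ) : ℤ → ℤ → ℂ := fun i j => ∑ᶠ k : ℤ, M i k * N k j

/-- The 2-cocycle `ω(A,B) = Σ_{i≤0, j≥1} A(i,j)B(j,i) − Σ_{i≥1, j≤0} A(i,j)B(j,i)`. -/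
def omegaC (A B : ℤ → ℤ → ℂ) : ℂ :=
  (∑ᶠ i : ℤ, ∑ᶠ j : ℤ, if i ≤ 0 ∧ 1 ≤ j then A i j * B j i else 0)
    - (∑ᶠ i : ℤ, ∑ᶠ j : ℤ, if 1 ≤ i ∧ j ≤ 0 then A i j * B j i else 0)

/-- The embedding `ι(Xs^m)`: its `(i,j)` entry is `X_{a,b}` when `i−1 = pℓ+a`,
`j−1 = qℓ+b` with `a,b ∈ {0,…,ℓ−1}` and `q−p = m`, and `0` otherwise. -/
def iota (ℓ : ℕ) (hℓ : 0 < ℓ) (X : Matrix (Fin ℓ) (Fin ℓ) ℂ) (m : ℤ) : ℤ → ℤ → ℂ :=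
  fun i j =>
    if (j - 1) / (ℓ : ℤ) - (i - 1) / (ℓ : ℤ) = m then
      X ⟨((i - 1) % (ℓ : ℤ)).toNat, by
            have h1 : 0 ≤ (i - 1) % (ℓ : ℤ) :=
              Int.emod_nonneg _ (by exact_mod_cast hℓ.ne')
            have h2 : (i - 1) % (ℓ : ℤ) < (ℓ : ℤ) :=
              Int.emod_lt_of_pos _ (by exact_mod_cast hℓ)
            omega⟩
        ⟨((j - 1) % (ℓ : ℤ)).toNat, by
            have h1 : 0 ≤ (j - 1) % (ℓ : ℤ) :=
              Int.emod_nonneg _ (by exact_mod_cast hℓ.ne')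
            have h2 : (j - 1) % (ℓ : ℤ) < (ℓ : ℤ) :=
              Int.emod_lt_of_pos _ (by exact_mod_cast hℓ)
            omega⟩
    else 0

/-- The integers, indexed from `1`, cut into blocks of length `ℓ`: the pair `(p, a)` is sent to
`p * ℓ + a + 1`. -/
def blockEquiv (ℓ : ℕ) (hℓ : 0 < ℓ) : ℤ × Fin ℓ ≃ ℤ where
  toFun x := x.1 * ℓ + x.2 + 1
  invFun i := ((i - 1) / (ℓ : ℤ), ⟨((i - 1) % (ℓ : ℤ)).toNat, by
    have h1 : 0 ≤ (i - 1) % (ℓ : ℤ) := Int.emod_nonneg _ (by omega)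
    have h2 : (i - 1) % (ℓ : ℤ) < (ℓ : ℤ) := Int.emod_lt_of_pos _ (by omega)
    omega⟩)
  left_inv x := by
    obtain ⟨p, a, ha⟩ := x
    have hℓ' : (ℓ : ℤ) ≠ 0 := by omega
    have hdiv : (a : ℤ) / ℓ = 0 := Int.ediv_eq_zero_of_lt (by omega) (by omega)
    have hmod : (a : ℤ) % ℓ = a := Int.emod_eq_of_lt (by omega) (by omega)
    ext
    · simp [add_comm (p * (ℓ : ℤ)), Int.add_mul_ediv_right _ _ hℓ', hdiv]
    · simp [add_comm (p * (ℓ : ℤ)), hmod]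
  right_inv i := by
    have h1 : 0 ≤ (i - 1) % (ℓ : ℤ) := Int.emod_nonneg _ (by omega)
    have h2 := Int.ediv_mul_add_emod (i - 1) ℓ
    simp only [Int.toNat_of_nonneg h1]
    omega

lemma iota_eq (ℓ : ℕ) (hℓ : 0 < ℓ) (X : Matrix (Fin ℓ) (Fin ℓ) ℂ) (m i j : ℤ) :
    iota ℓ hℓ X m i j =
      if ((blockEquiv ℓ hℓ).symm j).1 - ((blockEquiv ℓ hℓ).symm i).1 = m then
        X ((blockEquiv ℓ hℓ).symm i).2 ((blockEquiv ℓ hℓ).symm j).2 else 0 :=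
  rfl

lemma iota_blockEquiv (ℓ : ℕ) (hℓ : 0 < ℓ) (X : Matrix (Fin ℓ) (Fin ℓ) ℂ) (m : ℤ)
    (x y : ℤ × Fin ℓ) :
    iota ℓ hℓ X m (blockEquiv ℓ hℓ x) (blockEquiv ℓ hℓ y) =
      if y.1 - x.1 = m then X x.2 y.2 else 0 := by
  simp [iota_eq]

lemma blockEquiv_pos_iff (ℓ : ℕ) (hℓ : 0 < ℓ) (x : ℤ × Fin ℓ) :
    1 ≤ blockEquiv ℓ hℓ x ↔ 0 ≤ x.1 := by
  obtain ⟨p, a, ha⟩ := x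
  simp only [blockEquiv, Equiv.coe_fn_mk]
  constructor
  · intro h
    by_contra! hp
    nlinarith
  · intro h
    have := mul_nonneg h (Int.natCast_nonneg ℓ)
    omega

/-- A function supported on finitely many blocks is summed block by block. -/
lemma finsum_eq_sum_blocks {M : Type*} [AddCommMonoid M] (ℓ : ℕ) (hℓ : 0 < ℓ) (s : Finset ℤ)
    (F : ℤ → M) (hF : ∀ x : ℤ × Fin ℓ, x.1 ∉ s → F (blockEquiv ℓ hℓ x) = 0) :
    ∑ᶠ k, F k = ∑ q ∈ s, ∑ b, F (blockEquiv ℓ hℓ (q, b)) := by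
  rw [← finsum_comp_equiv (blockEquiv ℓ hℓ), ← Finset.sum_product']
  apply finsum_eq_sum_of_support_subset
  intro x hx
  by_contra h
  exact hx (hF x (by simpa using h))

lemma matMul_iota (ℓ : ℕ) (hℓ : 0 < ℓ) (X Y : Matrix (Fin ℓ) (Fin ℓ) ℂ) (m n : ℤ) :
    matMul (iota ℓ hℓ X m) (iota ℓ hℓ Y n) = iota ℓ hℓ (X * Y) (m + n) := by
  funext i j
  obtain ⟨x, rfl⟩ := (blockEquiv ℓ hℓ).surjective i
  obtain ⟨y, rfl⟩ := (blockEquiv ℓ hℓ).surjective j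
  rw [matMul, finsum_eq_sum_blocks ℓ hℓ {x.1 + m}]
  · have h : y.1 - (x.1 + m) = n ↔ y.1 - x.1 = m + n := by omega
    simp only [iota_blockEquiv, Finset.sum_singleton, h, add_sub_cancel_left, if_true]
    split_ifs <;> simp [Matrix.mul_apply]
  · intro z hz
    rw [iota_blockEquiv, if_neg, zero_mul]
    simp only [Finset.mem_singleton] at hz
    omega

/-- If on the `m`-th block diagonal the condition `C i j` says that the block of `i` lies in the
finite set `s`, then each block in `s` contributes `tr(XY)` to the sum over `C` when `m + n = 0`. -/
lemma finsum_finsum_iota_mul_iota (ℓ : ℕ) (hℓ : 0 < ℓ) (X Y : Matrix (Fin ℓ) (Fin ℓ) ℂ) (m n : ℤ)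
    (C : ℤ → ℤ → Prop) [∀ i j, Decidable (C i j)] (s : Finset ℤ)
    (hC : ∀ x y : ℤ × Fin ℓ, y.1 = x.1 + m →
      (C (blockEquiv ℓ hℓ x) (blockEquiv ℓ hℓ y) ↔ x.1 ∈ s)) :
    (∑ᶠ i : ℤ, ∑ᶠ j : ℤ, if C i j then iota ℓ hℓ X m i j * iota ℓ hℓ Y n j i else 0) =
      s.card * (if m + n = 0 then 1 else 0) * Matrix.trace (X * Y) := by
  have inner (x : ℤ × Fin ℓ) :
      (∑ᶠ j : ℤ, if C (blockEquiv ℓ hℓ x) j then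
        iota ℓ hℓ X m (blockEquiv ℓ hℓ x) j * iota ℓ hℓ Y n j (blockEquiv ℓ hℓ x) else 0) =
      if x.1 ∈ s then (if m + n = 0 then 1 else 0) * (X * Y) x.2 x.2 else 0 := by
    rw [finsum_eq_sum_blocks ℓ hℓ {x.1 + m}]
    · have h : x.1 - (x.1 + m) = n ↔ m + n = 0 := by omega
      simp only [iota_blockEquiv, Finset.sum_singleton, h, add_sub_cancel_left, if_true,
        hC x (x.1 + m, _) rfl]
      split_ifs <;> simp [Matrix.mul_apply]
    · intro z hz
      rw [iota_blockEquiv, if_neg (c := z.1 - x.1 = m), zero_mul, ite_self]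
      simp only [Finset.mem_singleton] at hz
      omega
  rw [finsum_eq_sum_blocks ℓ hℓ s]
  · simp only [inner]
    rw [Finset.sum_congr rfl (g := fun _ =>
      (if m + n = 0 then 1 else 0) * Matrix.trace (X * Y))]
    · simp
    · intro q hq
      simp [hq, Matrix.trace, Finset.mul_sum]
  · intro x hx
    rw [inner, if_neg hx]

lemma omegaC_iota (ℓ : ℕ) (hℓ : 0 < ℓ) (X Y : Matrix (Fin ℓ) (Fin ℓ) ℂ) (m n : ℤ) :
    omegaC (iota ℓ hℓ X m) (iota ℓ hℓ Y n) =
      (m : ℂ) * (if m + n = 0 then 1 else 0) * Matrix.trace (X * Y) := by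
  rw [omegaC,
    finsum_finsum_iota_mul_iota ℓ hℓ X Y m n (fun i j => i ≤ 0 ∧ 1 ≤ j) (Finset.Ico (-m) 0),
    finsum_finsum_iota_mul_iota ℓ hℓ X Y m n (fun i j => 1 ≤ i ∧ j ≤ 0) (Finset.Ico 0 (-m))]
  · have h : (((Finset.Ico (-m) 0).card : ℤ) : ℂ) - ((Finset.Ico 0 (-m)).card : ℤ) = m := by
      rw [← Int.cast_sub, Int.card_Ico, Int.card_Ico]
      congr 1
      omega
    push_cast at h
    rw [← sub_mul, ← sub_mul, h]
  all_goals
    intro x y hxy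
    have hx := blockEquiv_pos_iff ℓ hℓ x
    have hy := blockEquiv_pos_iff ℓ hℓ y
    rw [Finset.mem_Ico]
    omega

/-- `ι(Xs^m)·ι(Ys^n) = ι((XY)s^{m+n})`, hence
`[ι(Xs^m), ι(Ys^n)] = ι([X,Y]s^{m+n})`, and
`ω(ι(Xs^m), ι(Ys^n)) = m·δ_{m+n,0}·tr(XY)`. -/
theorem statement10 (ℓ : ℕ) (hℓ : 2 ≤ ℓ) (X Y : Matrix (Fin ℓ) (Fin ℓ) ℂ) (m n : ℤ) :
    matMul (iota ℓ (by omega) X m) (iota ℓ (by omega) Y n)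
      = iota ℓ (by omega) (X * Y) (m + n)
    ∧ (fun i j => matMul (iota ℓ (by omega) X m) (iota ℓ (by omega) Y n) i j
          - matMul (iota ℓ (by omega) Y n) (iota ℓ (by omega) X m) i j)
      = iota ℓ (by omega) (X * Y - Y * X) (m + n)
    ∧ omegaC (iota ℓ (by omega) X m) (iota ℓ (by omega) Y n)
      = (m : ℂ) * (if m + n = 0 then 1 else 0) * Matrix.trace (X * Y) := by
  refine ⟨matMul_iota ℓ _ X Y m n, ?_, omegaC_iota ℓ _ X Y m n⟩
  rw [matMul_iota, matMul_iota, add_comm n m]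
  funext i j
  simp only [iota_eq, Matrix.sub_apply]
  split_ifs <;> simp
end
end

section
/- Let N ≥ 1, let β₁,…,β_N ∈ ℂ be pairwise distinct, and let α₁,…,α_N ∈ ℂ satisfy α_j ≠ β_{j'} and β_j ≠ α_{j'} for all j ≠ j'. Set Γ = V_α V_β^{−1} with entries γ_{ij} = ∏_{k≠j}(α_i − β_k)/∏_{k≠j}(β_j − β_k). Then for every subset J ⊆ {1,…,N}, the principal minor Γ_J = (γ_{jj'})_{j,j'∈J} satisfies det(Γ_J) = (∏_{j∈J} γ_{jj}) · ∏_{j,j'∈J, j<j'} [(α_j − α_{j'})(β_j − β_{j'})] / [(α_j − β_{j'})(β_j − α_{j'})]. -/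
noncomputable section

open Finset in
theorem prod_prod_filter_lt_mul_eq_prod_prod_erase {ι M : Type*} [Fintype ι] [LinearOrder ι]
    [CommMonoid M] (f : ι → ι → M) :
    ∏ i, ∏ j with i < j, f i j * f j i = ∏ i, ∏ j ∈ univ.erase i, f i j := by
  have swap : ∏ i, ∏ j with i < j, f j i = ∏ i, ∏ j with j < i, f i j := by
    simp_rw [prod_filter]
    exact prod_comm
  simp_rw [prod_mul_distrib]
  rw [swap, ← prod_mul_distrib]
  refine prod_congr rfl fun i _ => ?_
  rw [← prod_union (disjoint_filter.2 fun j _ h => h.le.not_gt)]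
  congr 1
  ext j
  simp [lt_or_lt_iff_ne, eq_comm]

open Finset Polynomial in
/-- The matrix of values at `α i` of the products `∏_{k ≠ j} (X - β k)` has a determinant
that is a product of two Vandermonde determinants. -/
theorem det_prod_erase_sub_fin {K : Type*} [Field K] {n : ℕ} (α β : Fin n → K)
    (hβ : Function.Injective β) :
    Matrix.det (Matrix.of fun i j => ∏ k ∈ univ.erase j, (α i - β k))
      = ∏ i, ∏ j with i < j, ((α i - α j) * (β j - β i)) := by
  set C : Matrix (Fin n) (Fin n) K :=
    Matrix.of fun m j => (∏ k ∈ univ.erase j, (X - Polynomial.C (β k))).coeff m with hC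
  have eval_eq (v : Fin n → K) :
      (Matrix.of fun i j => ∏ k ∈ univ.erase j, (v i - β k)) = Matrix.vandermonde v * C := by
    ext i j
    have hdeg : (∏ k ∈ univ.erase j, (X - Polynomial.C (β k))).natDegree < n := by
      rw [natDegree_prod_of_monic _ _ fun k _ => monic_X_sub_C _]
      simpa using j.pos
    have h := eval_eq_sum_range' hdeg (v i)
    rw [eval_prod] at h
    simp only [eval_sub, eval_X, eval_C] at h
    rw [Matrix.of_apply, h, Matrix.mul_apply, sum_range]
    simp [hC, Matrix.vandermonde_apply, mul_comm]
  have hdiag : (Matrix.of fun i j => ∏ k ∈ univ.erase j, (β i - β k))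
      = Matrix.diagonal fun j => ∏ k ∈ univ.erase j, (β j - β k) := by
    ext i j
    rcases eq_or_ne i j with rfl | hij
    · simp
    · rw [Matrix.diagonal_apply_ne _ hij, Matrix.of_apply]
      exact prod_eq_zero (mem_erase.2 ⟨hij, mem_univ i⟩) (sub_self _)
  have hdetC : (Matrix.vandermonde β).det * C.det
      = ∏ i, ∏ j with i < j, ((β i - β j) * (β j - β i)) := by
    rw [← Matrix.det_mul, ← eval_eq, hdiag, Matrix.det_diagonal,
      prod_prod_filter_lt_mul_eq_prod_prod_erase fun i j => β i - β j]
  have vandermonde_det (v : Fin n → K) :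
      (Matrix.vandermonde v).det = ∏ i, ∏ j with i < j, (v j - v i) := by
    simp_rw [Matrix.det_vandermonde, filter_lt_eq_Ioi]
  rw [eval_eq, Matrix.det_mul]
  refine mul_left_cancel₀ (Matrix.det_vandermonde_ne_zero_iff.2 hβ) ?_
  rw [mul_left_comm, hdetC, vandermonde_det, vandermonde_det]
  simp_rw [← prod_mul_distrib]
  exact prod_congr rfl fun i _ => prod_congr rfl fun j _ => by ring

open Finset in
theorem det_prod_erase_sub {ι K : Type*} [Fintype ι] [LinearOrder ι] [Field K] (α β : ι → K)
    (hβ : Function.Injective β) :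
    Matrix.det (Matrix.of fun i j => ∏ k ∈ univ.erase j, (α i - β k))
      = ∏ i, ∏ j with i < j, ((α i - α j) * (β j - β i)) := by
  let e : Fin (Fintype.card ι) ≃o ι := Fintype.orderIsoFinOfCardEq ι rfl
  have h := det_prod_erase_sub_fin (α ∘ e) (β ∘ e) (hβ.comp e.injective)
  rw [← Matrix.det_submatrix_equiv_self e.toEquiv]
  convert h using 1
  · congr 1
    ext i j
    exact (prod_equiv (s := univ.erase j) (t := univ.erase (e j)) e.toEquiv (by simp) fun k _ => rfl).symm
  · refine (prod_equiv e.toEquiv (by simp) fun i _ => ?_).symm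
    exact prod_equiv e.toEquiv (by simp) fun j _ => rfl

open Finset in
/-- The determinant of a row and column scaling of the matrix `∏_{k ≠ j} (α i - β k)`,
relative to the product of its diagonal entries. -/
theorem det_scaled_prod_erase_sub {ι K : Type*} [Fintype ι] [LinearOrder ι] [Field K]
    (α β a b : ι → K) (hβ : Function.Injective β) (hαβ : ∀ i j, i ≠ j → α i ≠ β j) :
    Matrix.det (Matrix.of fun i j => a i * (b j * ∏ k ∈ univ.erase j, (α i - β k)))
      = (∏ i, a i * (b i * ∏ k ∈ univ.erase i, (α i - β k)))
        * ∏ i, ∏ j with i < j,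
            ((α i - α j) * (β i - β j)) / ((α i - β j) * (β i - α j)) := by
  rw [Matrix.det_mul_column a (fun i j => b j * ∏ k ∈ univ.erase j, (α i - β k))]
  have h : Matrix.det (fun i j => b j * ∏ k ∈ univ.erase j, (α i - β k))
      = (∏ j, b j) * Matrix.det (Matrix.of fun i j => ∏ k ∈ univ.erase j, (α i - β k)) :=
    Matrix.det_mul_row b _
  rw [h, det_prod_erase_sub α β hβ, prod_mul_distrib, prod_mul_distrib,
    ← prod_prod_filter_lt_mul_eq_prod_prod_erase fun i j => α i - β j, mul_assoc, mul_assoc]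
  congr 2
  simp_rw [← prod_mul_distrib]
  refine prod_congr rfl fun i _ => prod_congr rfl fun j hj => ?_
  have hij : i ≠ j := (mem_filter.1 hj).2.ne
  have h₁ : α i - β j ≠ 0 := sub_ne_zero.2 (hαβ i j hij)
  have h₂ : β i - α j ≠ 0 := sub_ne_zero.2 (hαβ j i hij.symm).symm
  field_simp
  ring

/-- let `β₁,…,β_N` be pairwise distinct and `α_j ≠ β_{j'}`, `β_j ≠ α_{j'}`
for `j ≠ j'`.  With `Γ = V_α V_β⁻¹`, whose entries are
`γ_{ij} = ∏_{k≠j}(α_i − β_k)/∏_{k≠j}(β_j − β_k)`, every principal minor satisfies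
`det Γ_J = (∏_{j∈J} γ_{jj}) · ∏_{j<j' ∈ J} (α_j−α_{j'})(β_j−β_{j'})/((α_j−β_{j'})(β_j−α_{j'}))`. -/
theorem statement15 (N : ℕ) (hN : 1 ≤ N) (α β : Fin N → ℂ)
    (hβ : Function.Injective β)
    (hαβ : ∀ j j' : Fin N, j ≠ j' → α j ≠ β j')
    (hβα : ∀ j j' : Fin N, j ≠ j' → β j ≠ α j')
    (γ : Fin N → Fin N → ℂ)
    (hγ : ∀ i j : Fin N,
      γ i j = (∏ k ∈ Finset.univ.erase j, (α i - β k))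
        / (∏ k ∈ Finset.univ.erase j, (β j - β k)))
    (hΓ : ∀ i j : Fin N,
      γ i j = ((Matrix.of fun i j : Fin N => α i ^ (j : ℕ))
        * (Matrix.of fun i j : Fin N => β i ^ (j : ℕ))⁻¹) i j) :
    ∀ J : Finset (Fin N),
      Matrix.det (Matrix.of fun j j' : {x // x ∈ J} => γ (j : Fin N) (j' : Fin N))
        = (∏ j ∈ J, γ j j)
          * ∏ j ∈ J, ∏ j' ∈ J.filter (fun j' => j < j'),
              ((α j - α j') * (β j - β j')) / ((α j - β j') * (β j - α j')) := by
  intro J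
  have hγJ (i j : {x // x ∈ J}) : γ i j = (∏ k ∈ Jᶜ, (α i - β k))
      * ((∏ k ∈ Finset.univ.erase (j : Fin N), (β j - β k))⁻¹
        * ∏ k ∈ Finset.univ.erase j, (α i - β k)) := by
    have hsplit : Finset.univ.erase (j : Fin N) = Jᶜ ∪ J.erase j := by
      ext k
      by_cases hk : k ∈ J
      · simp [hk]
      · simpa [hk] using fun h : k = j => hk (h ▸ j.2)
    have hdisj : Disjoint Jᶜ (J.erase (j : Fin N)) :=
      disjoint_compl_left.mono_right (Finset.erase_subset _ _)
    have hsub : ∏ k ∈ Finset.univ.erase j, (α i - β k)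
        = ∏ k ∈ J.erase (j : Fin N), (α i - β k) := by
      have himage : J.erase (j : Fin N)
          = (Finset.univ.erase j).map (Function.Embedding.subtype (· ∈ J)) := by
        rw [Finset.map_erase, Finset.univ_eq_attach, Finset.attach_map_val]
        rfl
      rw [himage, Finset.prod_map]
      rfl
    rw [hγ, hsub, div_eq_mul_inv, mul_left_comm, ← Finset.prod_union hdisj, ← hsplit, mul_comm]
  have hdet : Matrix.det (Matrix.of fun i j : {x // x ∈ J} => γ i j)
      = (∏ i : {x // x ∈ J}, γ i i) * ∏ i : {x // x ∈ J}, ∏ j : {x // x ∈ J} with i < j,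
          ((α i - α j) * (β i - β j)) / ((α i - β j) * (β i - α j)) := by
    simp only [hγJ]
    convert det_scaled_prod_erase_sub (fun i : {x // x ∈ J} => α i) (fun i => β i)
      (fun i => ∏ k ∈ Jᶜ, (α i - β k))
      (fun j => (∏ k ∈ Finset.univ.erase (j : Fin N), (β j - β k))⁻¹)
      (hβ.comp Subtype.val_injective) fun i j hij => hαβ i j (Subtype.coe_ne_coe.2 hij)
    rfl
  rw [hdet, Finset.prod_coe_sort J fun j => γ j j, ← Finset.prod_coe_sort J fun j =>
    ∏ j' ∈ J.filter (fun j' => j < j'),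
      ((α j - α j') * (β j - β j')) / ((α j - β j') * (β j - α j'))]
  congr 1
  refine Finset.prod_congr rfl fun i _ => ?_
  rw [Finset.prod_filter, Finset.prod_filter, ← Finset.prod_coe_sort J]
  rfl
end
end

section
/- Let N ≥ 1; let β₁,…,β_N ∈ ℂ be pairwise distinct, let α₁,…,α_N ∈ ℂ satisfy α_j ≠ β_{j'} and β_j ≠ α_{j'} for all j ≠ j', let c₁,…,c_N ∈ ℂ, let q₁,…,q_N ∈ ℂ, and let p₁,…,p_N ∈ ℂ be nonzero. Set γ_{jj} = ∏_{k≠j}(α_j − β_k)/∏_{k≠j}(β_j − β_k). Then det( p_i β_i^{j−1} + c_i q_i α_i^{j−1} )_{i,j=1,…,N} = (∏_{i=1}^N p_i) · (∏_{1≤j<i≤N}(β_i − β_j)) · Σ_{J ⊆ {1,…,N}} (∏_{j∈J} (c_j q_j / p_j)·γ_{jj}) · ∏_{j,j'∈J, j<j'} [(α_j − α_{j'})(β_j − β_{j'})] / [(α_j − β_{j'})(β_j − α_{j'})], where the sum runs over all subsets J of {1,…,N}. (With p_i = e^{ξ(β_i)} and q_i = e^{ξ(α_i)}, this identity shows that the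 Wronskian tau function τ_N^W equals the N-soliton tau function τ_N^S up to the factor e^{Σᵢξ(β_i)}·Δ(β).) -/
noncomputable section

open Finset in
theorem Finset.prod_prod_erase_eq_prod_prod_lt {ι M : Type*} [Fintype ι] [LinearOrder ι]
    [CommMonoid M] (f : ι → ι → M) :
    ∏ i, ∏ j ∈ univ.erase i, f i j = ∏ i, ∏ j with j < i, f i j * f j i := by
  have hsplit (i : ι) : ∏ j ∈ univ.erase i, f i j
      = (∏ j with j < i, f i j) * ∏ j with i < j, f i j := by
    rw [← prod_union (disjoint_filter.2 fun _ _ h => h.not_gt)]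
    congr 1
    ext j
    simp [← lt_or_lt_iff_ne]
  simp_rw [hsplit, prod_mul_distrib]
  congr 1
  exact prod_comm' (by simp)

open Finset in
theorem Matrix.det_vandermonde_eq_prod_lt {R : Type*} [CommRing R] {n : ℕ} (v : Fin n → R) :
    (Matrix.vandermonde v).det = ∏ i, ∏ j with j < i, (v i - v j) := by
  rw [Matrix.det_vandermonde]
  exact prod_comm' (by simp)

theorem Matrix.det_of_smul_pow_add_smul_pow {R : Type*} [CommRing R] {n : ℕ}
    (a b u v : Fin n → R) :
    (Matrix.of fun i j : Fin n => a i * u i ^ (j : ℕ) + b i * v i ^ (j : ℕ)).det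
      = ∑ J : Finset (Fin n), (∏ i, J.piecewise b a i)
          * (Matrix.vandermonde (J.piecewise v u)).det := by
  have h := (Matrix.detRowAlternating (n := Fin n) (R := R)).map_add_univ
    (fun i j => b i * v i ^ (j : ℕ)) (fun i j => a i * u i ^ (j : ℕ))
  rw [show (Matrix.of fun i j : Fin n => a i * u i ^ (j : ℕ) + b i * v i ^ (j : ℕ))
    = (fun i (j : Fin n) => b i * v i ^ (j : ℕ)) + fun i (j : Fin n) => a i * u i ^ (j : ℕ) by
      ext i j; exact add_comm _ _]
  refine h.trans (Finset.sum_congr rfl fun J _ => ?_)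
  rw [← Matrix.det_mul_column]
  congr 1
  ext i j
  by_cases hi : i ∈ J <;> simp [hi, Matrix.vandermonde]

open Finset in
theorem prod_lt_piecewise_sub_eq {ι K : Type*} [Fintype ι] [LinearOrder ι] [Field K]
    {α β : ι → K} (hβ : Function.Injective β) (hαβ : ∀ i j, i ≠ j → α i ≠ β j)
    (J : Finset ι) :
    ∏ i, ∏ j with j < i, (J.piecewise α β i - J.piecewise α β j)
      = (∏ i, ∏ j with j < i, (β i - β j))
        * ((∏ j ∈ J, (∏ k ∈ univ.erase j, (α j - β k)) / ∏ k ∈ univ.erase j, (β j - β k))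
          * ∏ j ∈ J, ∏ k ∈ J with j < k,
              ((α j - α k) * (β j - β k)) / ((α j - β k) * (β j - α k))) := by
  have hγ : ∏ j ∈ J, (∏ k ∈ univ.erase j, (α j - β k)) / ∏ k ∈ univ.erase j, (β j - β k)
      = ∏ i, ∏ j ∈ univ.erase i, if i ∈ J then (α i - β j) / (β i - β j) else 1 := by
    rw [← Fintype.prod_ite_mem]
    refine prod_congr rfl fun i _ => ?_
    split_ifs <;> simp [prod_div_distrib]
  have hpair : ∏ j ∈ J, ∏ k ∈ J with j < k,
        ((α j - α k) * (β j - β k)) / ((α j - β k) * (β j - α k))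
      = ∏ i, ∏ j with j < i, if i ∈ J ∧ j ∈ J then
          ((α j - α i) * (β j - β i)) / ((α j - β i) * (β j - α i)) else 1 := by
    simp_rw [← prod_filter, filter_filter]
    exact prod_comm' (by simp; tauto)
  rw [hγ, hpair, prod_prod_erase_eq_prod_prod_lt, ← prod_mul_distrib, ← prod_mul_distrib]
  refine prod_congr rfl fun i _ => ?_
  rw [← prod_mul_distrib, ← prod_mul_distrib]
  refine prod_congr rfl fun j hj => ?_
  have hne : i ≠ j := ((mem_filter.1 hj).2).ne'
  have h1 : β i - β j ≠ 0 := sub_ne_zero.2 (hβ.ne hne)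
  have h2 : β j - β i ≠ 0 := sub_ne_zero.2 (hβ.ne hne.symm)
  have h3 : α i - β j ≠ 0 := sub_ne_zero.2 (hαβ i j hne)
  have h4 : α j - β i ≠ 0 := sub_ne_zero.2 (hαβ j i hne.symm)
  have h5 : β j - α i ≠ 0 := sub_ne_zero.2 (hαβ i j hne).symm
  by_cases hi : i ∈ J <;> by_cases hj : j ∈ J <;> simp [hi, hj] <;> field_simp <;> ring


/-- the Wronskian/N-soliton determinant identity
`det( pᵢ βᵢ^{j−1} + cᵢ qᵢ αᵢ^{j−1} ) = (∏ pᵢ)·Δ(β)·Σ_{J} (∏_{j∈J}(c_j q_j/p_j)γ_{jj})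
  ∏_{j<j'∈J} (α_j−α_{j'})(β_j−β_{j'})/((α_j−β_{j'})(β_j−α_{j'}))`,
where `γ_{jj} = ∏_{k≠j}(α_j − β_k)/∏_{k≠j}(β_j − β_k)` and `Δ(β)` is the Vandermonde
determinant `∏_{j<i}(β_i − β_j)`. -/
theorem statement16 (N : ℕ) (hN : 1 ≤ N) (α β c q p : Fin N → ℂ)
    (hβ : Function.Injective β)
    (hαβ : ∀ j j' : Fin N, j ≠ j' → α j ≠ β j')
    (hβα : ∀ j j' : Fin N, j ≠ j' → β j ≠ α j')
    (hp : ∀ i, p i ≠ 0) :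
    Matrix.det (Matrix.of fun i j : Fin N => p i * β i ^ (j : ℕ) + c i * q i * α i ^ (j : ℕ))
      = (∏ i, p i)
        * (∏ i, ∏ j ∈ Finset.univ.filter (fun j => j < i), (β i - β j))
        * ∑ J ∈ (Finset.univ : Finset (Fin N)).powerset,
            (∏ j ∈ J, (c j * q j / p j)
              * ((∏ k ∈ Finset.univ.erase j, (α j - β k))
                  / (∏ k ∈ Finset.univ.erase j, (β j - β k))))
            * ∏ j ∈ J, ∏ j' ∈ J.filter (fun j' => j < j'),
                ((α j - α j') * (β j - β j')) / ((α j - β j') * (β j - α j')) := by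
  rw [Matrix.det_of_smul_pow_add_smul_pow, Finset.powerset_univ, Finset.mul_sum]
  refine Finset.sum_congr rfl fun J _ => ?_
  have hpq : ∏ i, J.piecewise (fun i => c i * q i) p i
      = (∏ i, p i) * ∏ j ∈ J, (c j * q j / p j) := by
    rw [← Fintype.prod_ite_mem J, ← Finset.prod_mul_distrib]
    refine Finset.prod_congr rfl fun i _ => ?_
    by_cases hi : i ∈ J
    · simp [hi, mul_div_cancel₀ _ (hp i)]
    · simp [hi]
  rw [hpq, Matrix.det_vandermonde_eq_prod_lt, prod_lt_piecewise_sub_eq hβ hαβ,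
    Finset.prod_mul_distrib]
  ring
end
end
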